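/- (Bounding Eve's information about the exchanged data.) Let F, B, T, T₂, B₂, Z₁, Z₂ be discrete random variables with finite ranges on a common probability space such that: (i) T is a deterministic function of F, T₂ is a deterministic function of T, and B₂ is a deterministic function of B; (ii) the pair (B, B₂) is independent of the triple (F, T, Z₁); and (iii) Z₂ is conditionally independent of (F, Z₁) given (T, B). Then I(F, B; Z₁, Z₂ | T₂, B₂) ≤ I(F; Z₁) + I(T, B; Z₂ | T₂, B₂). -/

import Mathlib

open scoped BigOperators Classical

noncomputable section

/-- `μ` is a probability mass function on the finite sample space `Ω`. -/
def IsProb {Ω : Type*} [Fintype Ω] (μ : Ω → ℝ) : Prop :=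
  (∀ ω, 0 ≤ μ ω) ∧ ∑ ω, μ ω = 1

/-- The probability that the discrete random variable `X` takes the value `a`. -/
def pr {Ω : Type*} [Fintype Ω] (μ : Ω → ℝ) {α : Type*} (X : Ω → α) (a : α) : ℝ :=
  ∑ ω ∈ Finset.univ.filter (fun ω => X ω = a), μ ω

/-- Shannon entropy (in bits) of a discrete random variable with finite range. -/
def H {Ω : Type*} [Fintype Ω] (μ : Ω → ℝ) {α : Type*} [Fintype α] (X : Ω → α) : ℝ :=
  -∑ a : α, pr μ X a * Real.logb 2 (pr μ X a)

/-- Conditional entropy `H(X | Y) = H(X, Y) − H(Y)` (in bits). -/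
def condH {Ω : Type*} [Fintype Ω] (μ : Ω → ℝ) {α β : Type*} [Fintype α] [Fintype β]
    (X : Ω → α) (Y : Ω → β) : ℝ :=
  H μ (fun ω => (X ω, Y ω)) - H μ Y

/-- Mutual information `I(X; Y) = H(X) + H(Y) − H(X, Y)` (in bits). -/
def MI {Ω : Type*} [Fintype Ω] (μ : Ω → ℝ) {α β : Type*} [Fintype α] [Fintype β]
    (X : Ω → α) (Y : Ω → β) : ℝ :=
  H μ X + H μ Y - H μ (fun ω => (X ω, Y ω))

/-- Conditional mutual information
`I(X; Y | Z) = H(X, Z) + H(Y, Z) − H(X, Y, Z) − H(Z)` (in bits). -/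
def CMI {Ω : Type*} [Fintype Ω] (μ : Ω → ℝ) {α β γ : Type*} [Fintype α] [Fintype β] [Fintype γ]
    (X : Ω → α) (Y : Ω → β) (Z : Ω → γ) : ℝ :=
  H μ (fun ω => (X ω, Z ω)) + H μ (fun ω => (Y ω, Z ω)) -
    H μ (fun ω => (X ω, Y ω, Z ω)) - H μ Z

/-- `X` and `Y` are conditionally independent given `Z`:
`P(X = a, Y = b, Z = c) · P(Z = c) = P(X = a, Z = c) · P(Y = b, Z = c)` for all `a, b, c`. -/
def CondIndep {Ω : Type*} [Fintype Ω] (μ : Ω → ℝ) {α β γ : Type*}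
    (X : Ω → α) (Y : Ω → β) (Z : Ω → γ) : Prop :=
  ∀ a b c, pr μ (fun ω => (X ω, Y ω, Z ω)) (a, b, c) * pr μ Z c =
    pr μ (fun ω => (X ω, Z ω)) (a, c) * pr μ (fun ω => (Y ω, Z ω)) (b, c)

/-- `X` and `Y` are independent: `P(X = a, Y = b) = P(X = a) · P(Y = b)` for all `a, b`. -/
def Indep {Ω : Type*} [Fintype Ω] (μ : Ω → ℝ) {α β : Type*}
    (X : Ω → α) (Y : Ω → β) : Prop :=
  ∀ a b, pr μ (fun ω => (X ω, Y ω)) (a, b) = pr μ X a * pr μ Y b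

theorem pr_expect {Ω : Type*} [Fintype Ω] (μ : Ω → ℝ) {α : Type*} [Fintype α] (X : Ω → α)
    (g : α → ℝ) : ∑ a, pr μ X a * g a = ∑ ω, μ ω * g (X ω) := by
  rw [← Finset.sum_fiberwise Finset.univ X]
  refine Finset.sum_congr rfl fun a _ => ?_
  rw [pr, Finset.sum_mul]
  refine Finset.sum_congr rfl fun ω hω => ?_
  rw [(Finset.mem_filter.1 hω).2]

theorem H_expect {Ω : Type*} [Fintype Ω] (μ : Ω → ℝ) {α : Type*} [Fintype α] (X : Ω → α) :
    H μ X = -∑ ω, μ ω * Real.logb 2 (pr μ X (X ω)) := by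
  rw [H, pr_expect μ X (fun a => Real.logb 2 (pr μ X a))]

theorem pr_congr {Ω : Type*} [Fintype Ω] (μ : Ω → ℝ) {α β : Type*} (X : Ω → α) (Y : Ω → β)
    (ω : Ω) (h : ∀ ω', X ω' = X ω ↔ Y ω' = Y ω) : pr μ X (X ω) = pr μ Y (Y ω) := by
  unfold pr
  refine Finset.sum_congr ?_ fun _ _ => rfl
  ext ω'
  simp [h]

theorem H_congr {Ω : Type*} [Fintype Ω] (μ : Ω → ℝ) {α β : Type*} [Fintype α] [Fintype β]
    (X : Ω → α) (Y : Ω → β)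
    (h : ∀ ω ω', X ω' = X ω ↔ Y ω' = Y ω) : H μ X = H μ Y := by
  rw [H_expect, H_expect]
  congr 1
  exact Finset.sum_congr rfl fun ω _ => by rw [pr_congr μ X Y ω (h ω)]

theorem pr_nonneg {Ω : Type*} [Fintype Ω] {μ : Ω → ℝ} (hμ : ∀ ω, 0 ≤ μ ω) {α : Type*}
    (X : Ω → α) (a : α) : 0 ≤ pr μ X a := Finset.sum_nonneg fun ω _ => hμ ω

theorem pr_pos {Ω : Type*} [Fintype Ω] {μ : Ω → ℝ} (hμ : ∀ ω, 0 ≤ μ ω) {α : Type*}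
    (X : Ω → α) (ω : Ω) (h : μ ω ≠ 0) : 0 < pr μ X (X ω) := by
  have h1 : μ ω ≤ pr μ X (X ω) :=
    Finset.single_le_sum (f := μ) (fun i _ => hμ i) (by simp)
  exact lt_of_lt_of_le (lt_of_le_of_ne (hμ ω) (Ne.symm h)) h1

theorem H_condIndep {Ω : Type*} [Fintype Ω] {μ : Ω → ℝ} (hμ : ∀ ω, 0 ≤ μ ω)
    {α β γ : Type*} [Fintype α] [Fintype β] [Fintype γ]
    (X : Ω → α) (Y : Ω → β) (Z : Ω → γ) (h : CondIndep μ X Y Z) :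
    H μ (fun ω => (X ω, Y ω, Z ω)) + H μ Z =
      H μ (fun ω => (X ω, Z ω)) + H μ (fun ω => (Y ω, Z ω)) := by
  simp only [H_expect]
  rw [← neg_add, ← neg_add, ← Finset.sum_add_distrib, ← Finset.sum_add_distrib]
  congr 1
  refine Finset.sum_congr rfl fun ω _ => ?_
  by_cases h0 : μ ω = 0
  · simp [h0]
  have e := h (X ω) (Y ω) (Z ω)
  have p1 := pr_pos hμ (fun ω => (X ω, Y ω, Z ω)) ω h0
  have p2 := pr_pos hμ Z ω h0
  have p3 := pr_pos hμ (fun ω => (X ω, Z ω)) ω h0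
  have p4 := pr_pos hμ (fun ω => (Y ω, Z ω)) ω h0
  rw [← mul_add, ← mul_add, ← Real.logb_mul p1.ne' p2.ne', ← Real.logb_mul p3.ne' p4.ne', e]

theorem H_indep {Ω : Type*} [Fintype Ω] {μ : Ω → ℝ} (hμ : ∀ ω, 0 ≤ μ ω)
    {α β : Type*} [Fintype α] [Fintype β]
    (X : Ω → α) (Y : Ω → β) (h : Indep μ X Y) :
    H μ (fun ω => (X ω, Y ω)) = H μ X + H μ Y := by
  simp only [H_expect]
  rw [← neg_add, ← Finset.sum_add_distrib]
  congr 1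
  refine Finset.sum_congr rfl fun ω _ => ?_
  by_cases h0 : μ ω = 0
  · simp [h0]
  have p2 := pr_pos hμ X ω h0
  have p3 := pr_pos hμ Y ω h0
  rw [← mul_add, ← Real.logb_mul p2.ne' p3.ne', h]

theorem pr_sum {Ω : Type*} [Fintype Ω] (μ : Ω → ℝ) {α : Type*} [Fintype α] (X : Ω → α) :
    ∑ a, pr μ X a = ∑ ω, μ ω := by
  simpa using pr_expect μ X (fun _ => 1)

theorem pr_marg {Ω : Type*} [Fintype Ω] (μ : Ω → ℝ) {α β : Type*} [Fintype α]
    (X : Ω → α) (Y : Ω → β) (b : β) :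
    ∑ a, pr μ (fun ω => (X ω, Y ω)) (a, b) = pr μ Y b := by
  simp only [pr]
  rw [← Finset.sum_fiberwise (Finset.univ.filter (fun ω => Y ω = b)) X]
  refine Finset.sum_congr rfl fun a _ => ?_
  refine Finset.sum_congr ?_ fun _ _ => rfl
  ext ω
  simp [and_comm]

theorem Indep.marg {Ω : Type*} [Fintype Ω] {μ : Ω → ℝ} {α β γ : Type*} [Fintype γ]
    {X : Ω → α} {Y : Ω → β} {Z : Ω → γ} (h : Indep μ X (fun ω => (Z ω, Y ω))) :
    Indep μ X Y := by
  intro a b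
  rw [← pr_marg μ Z Y b, Finset.mul_sum, ← pr_marg μ Z (fun ω => (X ω, Y ω))]
  refine Finset.sum_congr rfl fun c _ => ?_
  rw [← h]
  unfold pr
  refine Finset.sum_congr ?_ fun _ _ => rfl
  ext ω
  simp only [Finset.mem_filter, Finset.mem_univ, true_and, Prod.mk.injEq]
  tauto

theorem Indep.comp {Ω : Type*} [Fintype Ω] {μ : Ω → ℝ} {α β γ : Type*} [Fintype γ] [Fintype β]
    {X : Ω → α} {Y : Ω → β} (f : β → γ) (h : Indep μ X Y) :
    Indep μ X (fun ω => f (Y ω)) := by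
  refine Indep.marg (Z := Y) ?_
  rintro a ⟨b, c⟩
  by_cases hc : f b = c
  · have e := h a b
    convert e using 2
    all_goals
      unfold pr
      refine Finset.sum_congr ?_ fun _ _ => rfl
      ext ω
      simp only [Finset.mem_filter, Finset.mem_univ, true_and, Prod.mk.injEq]
      grind
  · have h1 : pr μ (fun ω => (X ω, Y ω, f (Y ω))) (a, b, c) = 0 := by
      unfold pr
      refine Finset.sum_eq_zero fun ω hω => ?_
      simp only [Finset.mem_filter, Finset.mem_univ, true_and, Prod.mk.injEq] at hω
      grind
    have h2 : pr μ (fun ω => (Y ω, f (Y ω))) (b, c) = 0 := by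
      unfold pr
      refine Finset.sum_eq_zero fun ω hω => ?_
      simp only [Finset.mem_filter, Finset.mem_univ, true_and, Prod.mk.injEq] at hω
      grind
    rw [h1, h2, mul_zero]

theorem H_subadd {Ω : Type*} [Fintype Ω] {μ : Ω → ℝ} (hμ : IsProb μ)
    {α β : Type*} [Fintype α] [Fintype β]
    (X : Ω → α) (Y : Ω → β) :
    H μ (fun ω => (X ω, Y ω)) ≤ H μ X + H μ Y := by
  have h2 : 0 < Real.log 2 := Real.log_pos (by norm_num)
  let g : α × β → ℝ := fun p =>
    pr μ X p.1 * pr μ Y p.2 / pr μ (fun ω => (X ω, Y ω)) p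
  have key : ∑ ω, μ ω * g (X ω, Y ω) ≤ 1 := by
    rw [← pr_expect μ (fun ω => (X ω, Y ω)) g]
    have : ∑ p : α × β, pr μ X p.1 * pr μ Y p.2 = 1 := by
      rw [Fintype.sum_prod_type, ← Fintype.sum_mul_sum, pr_sum, pr_sum, hμ.2, one_mul]
    rw [← this]
    refine Finset.sum_le_sum fun p _ => ?_
    by_cases h0 : pr μ (fun ω => (X ω, Y ω)) p = 0
    · rw [h0, zero_mul]
      exact mul_nonneg (pr_nonneg hμ.1 _ _) (pr_nonneg hμ.1 _ _)
    · exact (mul_div_cancel₀ _ h0).le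
  have pt : ∀ ω, μ ω * Real.logb 2 (pr μ X (X ω)) + μ ω * Real.logb 2 (pr μ Y (Y ω)) -
      μ ω * Real.logb 2 (pr μ (fun ω => (X ω, Y ω)) (X ω, Y ω)) ≤
      (μ ω * g (X ω, Y ω) - μ ω) / Real.log 2 := by
    intro ω
    by_cases h0 : μ ω = 0
    · simp [h0]
    have p1 := pr_pos hμ.1 (fun ω => (X ω, Y ω)) ω h0
    have p2 := pr_pos hμ.1 X ω h0
    have p3 := pr_pos hμ.1 Y ω h0
    have hl : Real.log (pr μ X (X ω)) + Real.log (pr μ Y (Y ω)) -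
        Real.log (pr μ (fun ω => (X ω, Y ω)) (X ω, Y ω)) ≤ g (X ω, Y ω) - 1 := by
      rw [← Real.log_mul p2.ne' p3.ne', ← Real.log_div (mul_pos p2 p3).ne' p1.ne']
      exact Real.log_le_sub_one_of_pos (div_pos (mul_pos p2 p3) p1)
    have := mul_le_mul_of_nonneg_left hl (hμ.1 ω)
    rw [le_div_iff₀ h2]
    simp only [Real.logb]
    field_simp
    linarith
  have s := Finset.sum_le_sum (s := Finset.univ) fun ω _ => pt ω
  rw [Finset.sum_sub_distrib, Finset.sum_add_distrib, ← Finset.sum_div,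
    Finset.sum_sub_distrib, hμ.2] at s
  have : (∑ ω, μ ω * g (X ω, Y ω) - 1) / Real.log 2 ≤ 0 :=
    div_nonpos_of_nonpos_of_nonneg (by linarith) h2.le
  simp only [H_expect]
  linarith

/-- Bounding Eve's information about the exchanged data: if `T` is a deterministic function of
`F`, `T₂` of `T`, and `B₂` of `B`, the pair `(B, B₂)` is independent of `(F, T, Z₁)`, and `Z₂`
is conditionally independent of `(F, Z₁)` given `(T, B)`, then
`I(F, B; Z₁, Z₂ | T₂, B₂) ≤ I(F; Z₁) + I(T, B; Z₂ | T₂, B₂)`. -/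
theorem eve_information_bound {Ω : Type*} [Fintype Ω] (μ : Ω → ℝ) (hμ : IsProb μ)
    {αF αB αT αT₂ αB₂ αZ₁ αZ₂ : Type*}
    [Fintype αF] [Fintype αB] [Fintype αT] [Fintype αT₂] [Fintype αB₂]
    [Fintype αZ₁] [Fintype αZ₂]
    (F : Ω → αF) (B : Ω → αB) (T : Ω → αT) (T₂ : Ω → αT₂) (B₂ : Ω → αB₂)
    (Z₁ : Ω → αZ₁) (Z₂ : Ω → αZ₂)
    (hT : ∃ f : αF → αT, ∀ ω, T ω = f (F ω))
    (hT₂ : ∃ g : αT → αT₂, ∀ ω, T₂ ω = g (T ω))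
    (hB₂ : ∃ h : αB → αB₂, ∀ ω, B₂ ω = h (B ω))
    (hind : Indep μ (fun ω => (B ω, B₂ ω)) (fun ω => (F ω, T ω, Z₁ ω)))
    (hci : CondIndep μ Z₂ (fun ω => (F ω, Z₁ ω)) (fun ω => (T ω, B ω))) :
    CMI μ (fun ω => (F ω, B ω)) (fun ω => (Z₁ ω, Z₂ ω)) (fun ω => (T₂ ω, B₂ ω)) ≤
      MI μ F Z₁ + CMI μ (fun ω => (T ω, B ω)) Z₂ (fun ω => (T₂ ω, B₂ ω)) := by
  obtain ⟨f, hf⟩ := hT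
  obtain ⟨g, hg⟩ := hT₂
  obtain ⟨k, hk⟩ := hB₂
  have i1 := H_indep hμ.1 _ _ (hind.comp (fun p => (p.1, p.2.2)))
  have i2 := H_indep hμ.1 _ _ (hind.comp (fun p => p.1))
  have c := H_condIndep hμ.1 _ _ _ hci
  have s := H_subadd hμ Z₁ (fun ω => (Z₂ ω, T₂ ω, B₂ ω))
  have e1 : H μ (fun ω => ((F ω, B ω), T₂ ω, B₂ ω)) = H μ (fun ω => ((B ω, B₂ ω), F ω)) :=
    H_congr μ _ _ fun ω ω' => by simp only [Prod.mk.injEq]; grind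
  have e2 : H μ (fun ω => ((Z₁ ω, Z₂ ω), T₂ ω, B₂ ω)) =
      H μ (fun ω => (Z₁ ω, Z₂ ω, T₂ ω, B₂ ω)) :=
    H_congr μ _ _ fun ω ω' => by simp only [Prod.mk.injEq]; grind
  have e3 : H μ (fun ω => ((F ω, B ω), (Z₁ ω, Z₂ ω), T₂ ω, B₂ ω)) =
      H μ (fun ω => (Z₂ ω, (F ω, Z₁ ω), T ω, B ω)) :=
    H_congr μ _ _ fun ω ω' => by simp only [Prod.mk.injEq]; grind
  have e4 : H μ (fun ω => ((F ω, Z₁ ω), T ω, B ω)) =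
      H μ (fun ω => ((B ω, B₂ ω), F ω, Z₁ ω)) :=
    H_congr μ _ _ fun ω ω' => by simp only [Prod.mk.injEq]; grind
  have e5 : H μ (fun ω => ((T ω, B ω), T₂ ω, B₂ ω)) = H μ (fun ω => (T ω, B ω)) :=
    H_congr μ _ _ fun ω ω' => by simp only [Prod.mk.injEq]; grind
  have e6 : H μ (fun ω => ((T ω, B ω), Z₂ ω, T₂ ω, B₂ ω)) = H μ (fun ω => (Z₂ ω, T ω, B ω)) :=
    H_congr μ _ _ fun ω ω' => by simp only [Prod.mk.injEq]; grind
  unfold CMI MI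
  linarith
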